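/- Generating function generalization for Laguerre polynomials: for parameters a, b (with b not a nonpositive integer), complex s, and z₁, z₂ in the open unit disc, ∑_{n=0}^∞ L_n^{(b-1)}(s) z₁^n · ₂F₁(-n, a; b; 1 - z₂/z₁) = (1-z₁)^{a-b} (1-z₂)^{-a} e^{s z₁/(z₁-1)} · ₁F₁(a; b; s(z₁-z₂)/((z₁-1)(z₂-1))). -/

import Mathlib

open Complex Finset

/-- Pochhammer symbol `(a)_n` for complex `a`. -/
noncomputable def poch (a : ℂ) (n : ℕ) : ℂ := ∏ i ∈ Finset.range n, (a + i)

/-- Confluent hypergeometric function `₁F₁(a; b; x)`. -/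
noncomputable def F11 (a b x : ℂ) : ℂ :=
  ∑' k : ℕ, poch a k * x ^ k / (poch b k * k.factorial)

/-- Gauss hypergeometric function `₂F₁(a, b; c; x)`. -/
noncomputable def F21 (a b c x : ℂ) : ℂ :=
  ∑' k : ℕ, poch a k * poch b k * x ^ k / (poch c k * k.factorial)

/-- Generalized Laguerre polynomial `L_n^{(α)}(x)`. -/
noncomputable def laguerre (n : ℕ) (α x : ℂ) : ℂ :=
  poch (α + 1) n / n.factorial * F11 (-(n : ℂ)) (α + 1) x

open Filter Topology
noncomputable def cf (c : ℂ) (n : ℕ) : ℂ := poch c n / n.factorial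

lemma poch_succ (c : ℂ) (n : ℕ) : poch c (n+1) = poch c n * (c + n) := by
  simp [poch, Finset.prod_range_succ]

lemma poch_zero (c : ℂ) : poch c 0 = 1 := by simp [poch]

lemma poch_add (c : ℂ) (p i : ℕ) : poch c (p + i) = poch c p * poch (c + p) i := by
  simp only [poch, Finset.prod_range_add]
  congr 1
  refine Finset.prod_congr rfl fun x _ => ?_
  push_cast; ring

lemma poch_ne (b : ℂ) (hb : ∀ m : ℕ, b ≠ -(m : ℂ)) (n : ℕ) : poch b n ≠ 0 := by
  unfold poch
  refine Finset.prod_ne_zero_iff.mpr fun i _ h => hb i ?_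
  linear_combination h

lemma poch_neg (n k : ℕ) (h : n < k) : poch (-(n:ℂ)) k = 0 := by
  unfold poch
  exact Finset.prod_eq_zero (Finset.mem_range.mpr h) (by simp)

lemma poch_neg' (n k : ℕ) : poch (-(n:ℂ)) k = (-1)^k * (n.choose k) * k.factorial := by
  induction k with
  | zero => simp [poch]
  | succ k ih =>
    rw [poch_succ, ih]
    rcases le_or_gt k n with h | h
    · have h1 := Nat.choose_succ_right_eq n k
      have h2 : ((n.choose (k+1) : ℕ):ℂ) * (k+1) = n.choose k * (n - k) := by
        rw [← Nat.cast_sub h]; exact_mod_cast h1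
      rw [Nat.factorial_succ]; push_cast
      linear_combination (-(-1)^(k+1)) * (k.factorial : ℂ) * h2
    · simp [Nat.choose_eq_zero_of_lt h, Nat.choose_eq_zero_of_lt (show n < k+1 by omega)]

lemma cf_choose (c : ℂ) (p i : ℕ) :
    ((p + i).choose p : ℂ) * cf c (p + i) = cf c p * cf (c + p) i := by
  have h : (((p+i).choose p * p.factorial * i.factorial : ℕ) : ℂ) = ((p+i).factorial : ℕ) := by
    congr 1
    rw [Nat.choose_symm_add]
    exact Nat.add_choose_mul_factorial_mul_factorial p i
  unfold cf
  rw [poch_add]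
  have := Nat.factorial_ne_zero p
  have := Nat.factorial_ne_zero i
  have := Nat.factorial_ne_zero (p+i)
  push_cast at h
  field_simp
  linear_combination poch c p * poch (c+p) i * h

lemma cf_eq (c : ℂ) (n : ℕ) : cf c n = (-1)^n * Ring.choose (-c) n := by
  have : ((n.factorial : ℕ) : ℂ) ≠ 0 := by exact_mod_cast Nat.factorial_ne_zero n
  have h : poch c n = (n.factorial : ℂ) * Ring.multichoose c n := by
    rw [← nsmul_eq_mul, Ring.factorial_nsmul_multichoose_eq_ascPochhammer]
    rw [Polynomial.ascPochhammer_smeval_cast, Polynomial.ascPochhammer_smeval_eq_eval]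
    clear this
    induction n with
    | zero => simp [poch]
    | succ n ih => rw [poch_succ, ih, ascPochhammer_succ_eval]
  rw [Ring.choose_neg', cf, h]
  simp [Int.negOnePow_def, Units.smul_def, ← mul_assoc, ← mul_pow]
  field_simp

lemma cf_add (c d : ℂ) (n : ℕ) :
    cf (c + d) n = ∑ ij ∈ antidiagonal n, cf c ij.1 * cf d ij.2 := by
  rw [cf_eq, neg_add, Ring.add_choose_eq n (Commute.all _ _), Finset.mul_sum]
  refine Finset.sum_congr rfl fun ij h => ?_
  rw [cf_eq, cf_eq, ← Finset.HasAntidiagonal.mem_antidiagonal.mp h, pow_add]; ring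

lemma cf_hasSum (c z : ℂ) (hz : ‖z‖ < 1) :
    HasSum (fun n => cf c n * z ^ n) ((1 - z) ^ (-c)) := by
  have h := (Complex.one_add_cpow_hasFPowerSeriesOnBall_zero (a := -c)).hasSum
    (y := -z) (by simpa [enorm_eq_nnnorm, ← NNReal.coe_lt_coe] using hz)
  simp only [zero_add, binomialSeries_apply, List.ofFn_const, List.prod_replicate] at h
  rw [sub_eq_add_neg]
  have e : (fun n => cf c n * z ^ n) = fun n => Ring.choose (-c) n • (-z) ^ n := by
    funext n
    rw [cf_eq, neg_pow z, smul_eq_mul]; ring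
  rw [e]; exact h

lemma cf_norm_summable (c z : ℂ) (hz : ‖z‖ < 1) : Summable fun n => ‖cf c n * z ^ n‖ :=
  (cf_hasSum c z hz).summable.norm

lemma sum_triple (n : ℕ) (f : ℕ → ℕ → ℕ → ℂ) :
    ∑ ij ∈ antidiagonal n, ∑ mr ∈ antidiagonal ij.2, f ij.1 mr.1 mr.2
      = ∑ ml ∈ antidiagonal n, ∑ ir ∈ antidiagonal ml.2, f ir.1 ml.1 ir.2 := by
  rw [Finset.sum_sigma', Finset.sum_sigma']
  refine Finset.sum_bij' (fun x _ => ⟨(x.2.1, x.1.1 + x.2.2), (x.1.1, x.2.2)⟩)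
    (fun x _ => ⟨(x.2.1, x.1.1 + x.2.2), (x.1.1, x.2.2)⟩) ?_ ?_ ?_ ?_ ?_
  · rintro ⟨⟨i, j⟩, ⟨m, r⟩⟩ h
    simp only [Finset.mem_sigma, Finset.HasAntidiagonal.mem_antidiagonal] at h ⊢
    refine ⟨?_, ?_⟩
    · omega
    · trivial
  · rintro ⟨⟨i, j⟩, ⟨m, r⟩⟩ h
    simp only [Finset.mem_sigma, Finset.HasAntidiagonal.mem_antidiagonal] at h ⊢
    refine ⟨?_, ?_⟩
    · omega
    · trivial
  · rintro ⟨⟨i, j⟩, ⟨m, r⟩⟩ h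
    simp only [Finset.mem_sigma, Finset.HasAntidiagonal.mem_antidiagonal] at h ⊢
    obtain ⟨h1, rfl⟩ := h
    rfl
  · rintro ⟨⟨i, j⟩, ⟨m, r⟩⟩ h
    simp only [Finset.mem_sigma, Finset.HasAntidiagonal.mem_antidiagonal] at h ⊢
    obtain ⟨h1, rfl⟩ := h
    rfl
  · rintro ⟨⟨i, j⟩, ⟨m, r⟩⟩ h
    rfl

/-- Coefficients of `(1 - x t)^(-c) (1 - y t)^(-a)`. -/
noncomputable def Gp (c a x y : ℂ) (n : ℕ) : ℂ :=
  ∑ ij ∈ antidiagonal n, (cf c ij.1 * x ^ ij.1) * (cf a ij.2 * y ^ ij.2)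

lemma Gp_eq (c a x y : ℂ) (n : ℕ) :
    Gp c a x y n = ∑ ml ∈ antidiagonal n,
      cf a ml.1 * (y - x) ^ ml.1 * (cf (c + a + ml.1) ml.2 * x ^ ml.2) := by
  have h1 : Gp c a x y n = ∑ ij ∈ antidiagonal n, ∑ mr ∈ antidiagonal ij.2,
      cf c ij.1 * x ^ ij.1 * (cf a mr.1 * cf (a + mr.1) mr.2 * ((y - x) ^ mr.1 * x ^ mr.2)) := by
    refine Finset.sum_congr rfl fun ij _ => ?_
    have : y ^ ij.2 = ((y - x) + x) ^ ij.2 := by ring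
    rw [this, (Commute.all _ _).add_pow', Finset.mul_sum, Finset.mul_sum]
    refine Finset.sum_congr rfl fun mr h => ?_
    rw [← cf_choose, Finset.HasAntidiagonal.mem_antidiagonal.mp h, nsmul_eq_mul]; ring
  rw [h1, sum_triple n fun i m r =>
    cf c i * x ^ i * (cf a m * cf (a + m) r * ((y - x) ^ m * x ^ r))]
  refine Finset.sum_congr rfl fun ml _ => ?_
  rw [show c + a + (ml.1 : ℂ) = c + (a + ml.1) by ring, cf_add, Finset.sum_mul, Finset.mul_sum]
  refine Finset.sum_congr rfl fun ir h => ?_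
  rw [← Finset.HasAntidiagonal.mem_antidiagonal.mp h, pow_add]; ring

lemma F11_neg (n : ℕ) (b s : ℂ) :
    F11 (-(n : ℂ)) b s = ∑ k ∈ Finset.range (n + 1), (n.choose k : ℂ) * ((-s) ^ k / poch b k) := by
  unfold F11
  rw [tsum_eq_sum (s := Finset.range (n + 1))]
  · refine Finset.sum_congr rfl fun k _ => ?_
    have : ((k.factorial : ℕ) : ℂ) ≠ 0 := by exact_mod_cast Nat.factorial_ne_zero k
    rw [poch_neg', neg_pow s]
    rw [← div_div, div_eq_iff this]
    ring
  · intro k hk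
    rw [poch_neg n k (by simpa using hk)]; simp

lemma G_eq_F21 (n : ℕ) (a b z₁ z₂ : ℂ) (hb : ∀ m : ℕ, b ≠ -(m : ℂ)) (h0 : z₁ ≠ 0) :
    poch b n / n.factorial * z₁ ^ n * F21 (-(n : ℂ)) a b (1 - z₂ / z₁) = Gp (b - a) a z₁ z₂ n := by
  unfold F21
  rw [tsum_eq_sum (s := Finset.range (n + 1)), Gp_eq,
    Finset.Nat.sum_antidiagonal_eq_sum_range_succ_mk, Finset.mul_sum]
  · refine Finset.sum_congr rfl fun k hk => ?_
    obtain ⟨l, rfl⟩ := Nat.exists_eq_add_of_le (Nat.lt_succ_iff.mp (Finset.mem_range.mp hk))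
    have hk := Nat.factorial_ne_zero k
    have hkl := Nat.factorial_ne_zero (k + l)
    have hc := cf_choose b k l
    have hp := poch_ne b hb k
    have e : 1 - z₂ / z₁ = -(z₂ - z₁) / z₁ := by field_simp; ring
    have e2 : (-1 : ℂ) ^ k * (-1) ^ k = 1 := by rw [← mul_pow]; simp
    rw [poch_neg', e, div_pow, neg_pow (z₂ - z₁)]
    simp only [Nat.add_sub_cancel_left, sub_add_cancel]
    rw [show poch b (k + l) / ((k + l).factorial : ℂ) = cf b (k + l) from rfl]
    have hc2 : cf (b + k) l = (k.factorial : ℂ) / poch b k * (((k + l).choose k : ℂ) * cf b (k + l)) := by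
      rw [hc, cf.eq_def b k]; field_simp
    rw [hc2, cf.eq_def a, pow_add]
    field_simp
    linear_combination (cf b (k+l) * (k+l).choose k * poch a k * (z₂ - z₁)^k) * e2
  · intro k hk
    rw [poch_neg n k (by simpa using hk)]; simp

lemma lag_term (n : ℕ) (a b s z₁ z₂ : ℂ) (hb : ∀ m : ℕ, b ≠ -(m : ℂ)) (h0 : z₁ ≠ 0) :
    laguerre n (b - 1) s * z₁ ^ n * F21 (-(n : ℂ)) a b (1 - z₂ / z₁)
     = ∑ k ∈ Finset.range (n + 1), (n.choose k : ℂ) * ((-s) ^ k / poch b k) * Gp (b - a) a z₁ z₂ n := by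
  rw [← Finset.sum_mul, ← F11_neg, ← G_eq_F21 n a b z₁ z₂ hb h0, laguerre, sub_add_cancel]
  ring

lemma cf_choose_hasSum (c z : ℂ) (hz : ‖z‖ < 1) (p : ℕ) :
    HasSum (fun i => (i.choose p : ℂ) * (cf c i * z ^ i))
      ((1 - z) ^ (-c) * (cf c p * (z / (1 - z)) ^ p)) := by
  have hz1 : 1 - z ≠ 0 := by
    intro h
    rw [← sub_eq_zero.mp h] at hz; simp at hz
  rw [← hasSum_nat_add_iff' p, Finset.sum_eq_zero, sub_zero]
  · have h := (cf_hasSum (c + p) z hz).mul_left (cf c p * z ^ p)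
    have e : (1 - z) ^ (-c) * (cf c p * (z / (1 - z)) ^ p)
        = cf c p * z ^ p * (1 - z) ^ (-(c + p)) := by
      rw [neg_add, Complex.cpow_add _ _ hz1, Complex.cpow_neg _ (p : ℂ), Complex.cpow_natCast,
        div_pow]
      ring
    rw [e]
    refine h.congr_fun fun i => ?_
    rw [show i + p = p + i by ring, ← mul_assoc, cf_choose, pow_add]
    ring
  · intro i hi
    rw [Nat.choose_eq_zero_of_lt (Finset.mem_range.mp hi)]; simp


lemma cauchy_hasSum {f g : ℕ → ℂ} {u v : ℂ} (hf : HasSum f u) (hg : HasSum g v) :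
    HasSum (fun n => ∑ ij ∈ antidiagonal n, f ij.1 * g ij.2) (u * v) := by
  have h := tsum_mul_tsum_eq_tsum_sum_antidiagonal_of_summable_norm hf.summable.norm
    hg.summable.norm
  rw [hf.tsum_eq, hg.tsum_eq] at h
  rw [h]
  exact (summable_norm_sum_mul_antidiagonal_of_summable_norm hf.summable.norm
    hg.summable.norm).of_norm.hasSum

lemma Gp_choose_hasSum (c a z₁ z₂ : ℂ) (h₁ : ‖z₁‖ < 1) (h₂ : ‖z₂‖ < 1) (k : ℕ) :
    HasSum (fun n => (n.choose k : ℂ) * Gp c a z₁ z₂ n)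
      ((1 - z₁) ^ (-c) * (1 - z₂) ^ (-a) * Gp c a (z₁ / (1 - z₁)) (z₂ / (1 - z₂)) k) := by
  have h := hasSum_sum (s := antidiagonal k) fun (pq : ℕ × ℕ) _ =>
    cauchy_hasSum (cf_choose_hasSum c z₁ h₁ pq.1) (cf_choose_hasSum a z₂ h₂ pq.2)
  have e : (1 - z₁) ^ (-c) * (1 - z₂) ^ (-a) * Gp c a (z₁ / (1 - z₁)) (z₂ / (1 - z₂)) k
    = ∑ pq ∈ antidiagonal k, (1 - z₁) ^ (-c) * (cf c pq.1 * (z₁ / (1 - z₁)) ^ pq.1) *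
      ((1 - z₂) ^ (-a) * (cf a pq.2 * (z₂ / (1 - z₂)) ^ pq.2)) := by
    rw [Gp, Finset.mul_sum]
    refine Finset.sum_congr rfl fun pq _ => ?_
    ring
  rw [e]
  refine h.congr_fun fun n => ?_
  rw [Finset.sum_comm, Gp, Finset.mul_sum]
  refine Finset.sum_congr rfl fun ij hij => ?_
  rw [← Finset.HasAntidiagonal.mem_antidiagonal.mp hij, Nat.add_choose_eq, Nat.cast_sum,
    Finset.sum_mul]
  refine Finset.sum_congr rfl fun pq _ => ?_
  push_cast; ring

lemma poch_inv_summable (b : ℂ) (hb : ∀ m : ℕ, b ≠ -(m : ℂ)) (x : ℂ) :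
    Summable fun k => x ^ k / poch b k := by
  rcases eq_or_ne x 0 with rfl | hx
  · refine summable_of_ne_finset_zero (s := {0}) fun k hk => ?_
    rw [zero_pow (by simpa using hk), zero_div]
  refine summable_of_ratio_test_tendsto_lt_one (l := 0) one_pos
    (Eventually.of_forall fun k => div_ne_zero (pow_ne_zero _ hx) (poch_ne b hb k)) ?_
  have e : ∀ k : ℕ, ‖x ^ (k + 1) / poch b (k + 1)‖ / ‖x ^ k / poch b k‖ = ‖x‖ / ‖b + k‖ := by
    intro k
    have := poch_ne b hb k
    have := poch_ne b hb (k + 1)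
    rw [← norm_div, ← norm_div, poch_succ]
    rw [poch_succ] at this
    have h3 : b + k ≠ 0 := right_ne_zero_of_mul this
    congr 1
    rw [pow_succ]
    field_simp
  simp only [e]
  refine Tendsto.div_atTop tendsto_const_nhds ?_
  refine tendsto_atTop_mono (f := fun k : ℕ => (k : ℝ) - ‖b‖) (fun k => ?_)
    (tendsto_atTop_add_const_right _ _ tendsto_natCast_atTop_atTop)
  have := norm_sub_le (b + k) b
  simp at this
  linarith

lemma F11_summable (a b : ℂ) (hb : ∀ m : ℕ, b ≠ -(m : ℂ)) (x : ℂ) :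
    Summable fun k : ℕ => poch a k * x ^ k / (poch b k * k.factorial) := by
  have h1 := (cf_hasSum a (1 / 2) (by norm_num)).summable
  have h2 := (poch_inv_summable b hb (2 * x)).norm
  obtain ⟨C, hC⟩ := h1.tendsto_atTop_zero.norm.bddAbove_range
  refine Summable.of_norm_bounded (h2.mul_left C) fun k => ?_
  have h3 : ‖cf a k * (1 / 2) ^ k‖ ≤ C := hC ⟨k, rfl⟩
  have e : poch a k * x ^ k / (poch b k * k.factorial)
      = (cf a k * (1 / 2) ^ k) * ((2 * x) ^ k / poch b k) := by
    rw [mul_pow, cf, div_pow, one_pow]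
    field_simp
  rw [e, norm_mul]
  gcongr

lemma final_sum (a b s w₁ w₂ : ℂ) (hb : ∀ m : ℕ, b ≠ -(m : ℂ)) :
    HasSum (fun k => (-s) ^ k / poch b k * Gp (b - a) a w₁ w₂ k)
      (F11 a b (s * (w₁ - w₂)) * Complex.exp (-s * w₁)) := by
  have h1 := (F11_summable a b hb (s * (w₁ - w₂))).hasSum
  have h2 : HasSum (fun n : ℕ => (-s * w₁) ^ n / (n.factorial : ℂ)) (Complex.exp (-s * w₁)) := by
    rw [Complex.exp_eq_exp_ℂ]
    exact NormedSpace.expSeries_div_hasSum_exp (-s * w₁)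
  refine (cauchy_hasSum h1 h2).congr_fun fun k => ?_
  rw [Gp_eq, Finset.mul_sum]
  refine Finset.sum_congr rfl fun ml h => ?_
  obtain ⟨m, l⟩ := ml
  obtain rfl := Finset.HasAntidiagonal.mem_antidiagonal.mp h
  simp only [sub_add_cancel]
  have := poch_ne b hb (m + l)
  rw [poch_add] at this ⊢
  have h3 := left_ne_zero_of_mul this
  have h4 := right_ne_zero_of_mul this
  have := Nat.factorial_ne_zero m
  have := Nat.factorial_ne_zero l
  rw [cf, cf, mul_pow, mul_pow, pow_add, show w₂ - w₁ = (-1) * (w₁ - w₂) by ring, mul_pow, neg_pow s m]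
  have e2 : (-1 : ℂ) ^ m * (-1) ^ m = 1 := by rw [← mul_pow]; simp
  field_simp
  linear_combination (s ^ m * poch a m * w₁ ^ l * (w₁ - w₂) ^ m * (-s) ^ l) * e2

lemma Gp_scale (c a x y r : ℂ) (n : ℕ) : Gp c a (r * x) (r * y) n = r ^ n * Gp c a x y n := by
  rw [Gp, Gp, Finset.mul_sum]
  refine Finset.sum_congr rfl fun ij h => ?_
  rw [← Finset.HasAntidiagonal.mem_antidiagonal.mp h, pow_add, mul_pow, mul_pow]; ring

lemma Gp_norm_summable (c a z₁ z₂ : ℂ) (h₁ : ‖z₁‖ < 1) (h₂ : ‖z₂‖ < 1) :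
    Summable fun n => ‖Gp c a z₁ z₂ n‖ := by
  unfold Gp
  exact summable_norm_sum_mul_antidiagonal_of_summable_norm
    (f := fun i => cf c i * z₁ ^ i) (g := fun j => cf a j * z₂ ^ j)
    (cf_norm_summable _ _ h₁) (cf_norm_summable _ _ h₂)

lemma double_summable (a b s z₁ z₂ : ℂ) (hb : ∀ m : ℕ, b ≠ -(m : ℂ))
    (h₁ : ‖z₁‖ < 1) (h₂ : ‖z₂‖ < 1) :
    Summable (Function.uncurry fun n k : ℕ =>
      (n.choose k : ℂ) * ((-s) ^ k / poch b k) * Gp (b - a) a z₁ z₂ n) := by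
  obtain ⟨ρ, hρ, hρ1⟩ := exists_between (max_lt h₁ h₂)
  have hρ0 : 0 < ρ := lt_of_le_of_lt ((norm_nonneg z₁).trans (le_max_left _ _)) hρ
  set δ : ℝ := 1 / ρ - 1 with hδ
  have hδ0 : 0 < δ := by
    have : 1 < 1 / ρ := by rw [lt_div_iff₀ hρ0]; linarith
    linarith
  have hr : ‖(((1 / ρ : ℝ)) : ℂ)‖ = 1 / ρ := by
    rw [Complex.norm_real, Real.norm_eq_abs, abs_of_pos (by positivity)]
  have hG : Summable fun n => ‖Gp (b - a) a (((1 / ρ : ℝ) : ℂ) * z₁) (((1 / ρ : ℝ) : ℂ) * z₂) n‖ := by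
    refine Gp_norm_summable _ _ _ _ ?_ ?_
    · rw [norm_mul, hr, one_div, inv_mul_lt_iff₀ hρ0, mul_one]
      exact lt_of_le_of_lt (le_max_left _ _) hρ
    · rw [norm_mul, hr, one_div, inv_mul_lt_iff₀ hρ0, mul_one]
      exact lt_of_le_of_lt (le_max_right _ _) hρ
  simp only [Gp_scale, norm_mul, norm_pow, hr] at hG
  obtain ⟨M, hM⟩ := (poch_inv_summable b hb (-s / (δ : ℂ))).tendsto_atTop_zero.norm.bddAbove_range
  have hM' : ∀ k : ℕ, ‖(-s) ^ k / poch b k‖ ≤ M * δ ^ k := by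
    intro k
    have h3 : ‖(-s / (δ : ℂ)) ^ k / poch b k‖ ≤ M := hM ⟨k, rfl⟩
    have hδc : (δ : ℂ) ≠ 0 := by exact_mod_cast hδ0.ne'
    have e : (-s) ^ k / poch b k = (-s / (δ : ℂ)) ^ k / poch b k * (δ : ℂ) ^ k := by
      rw [div_pow]; field_simp
    rw [e, norm_mul, norm_pow, Complex.norm_real, Real.norm_eq_abs, abs_of_pos hδ0]
    gcongr
  have hsum : ∀ n : ℕ, HasSum (fun k : ℕ => (n.choose k : ℝ) * (M * δ ^ k) * ‖Gp (b - a) a z₁ z₂ n‖)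
      (M * ((1 / ρ) ^ n * ‖Gp (b - a) a z₁ z₂ n‖)) := by
    intro n
    have e : M * ((1 / ρ) ^ n * ‖Gp (b - a) a z₁ z₂ n‖) = ∑ k ∈ Finset.range (n + 1),
        (n.choose k : ℝ) * (M * δ ^ k) * ‖Gp (b - a) a z₁ z₂ n‖ := by
      rw [show 1 / ρ = δ + 1 by rw [hδ]; ring, add_pow, Finset.sum_mul, Finset.mul_sum]
      refine Finset.sum_congr rfl fun k _ => ?_
      rw [one_pow]; ring
    rw [e]
    refine hasSum_sum_of_ne_finset_zero fun k hk => ?_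
    rw [Nat.choose_eq_zero_of_lt (by simpa using hk)]; simp
  have hM0 : 0 ≤ M := (norm_nonneg _).trans (hM ⟨0, rfl⟩)
  have hmaj : Summable fun x : ℕ × ℕ =>
      (x.1.choose x.2 : ℝ) * (M * δ ^ x.2) * ‖Gp (b - a) a z₁ z₂ x.1‖ := by
    rw [summable_prod_of_nonneg fun x => by positivity]
    refine ⟨fun n => (hsum n).summable, ?_⟩
    simp only [fun n => (hsum n).tsum_eq]
    exact hG.mul_left M
  refine Summable.of_norm_bounded hmaj fun x => ?_
  obtain ⟨n, k⟩ := x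
  simp only [Function.uncurry]
  rw [norm_mul, norm_mul, Complex.norm_natCast]
  gcongr
  exact hM' k

/-- Generalized generating function for Laguerre polynomials:
`∑ L_n^{(b-1)}(s) z₁^n ₂F₁(-n, a; b; 1-z₂/z₁)
   = (1-z₁)^{a-b} (1-z₂)^{-a} e^{sz₁/(z₁-1)} ₁F₁(a; b; s(z₁-z₂)/((z₁-1)(z₂-1)))`. -/
theorem laguerre_gauss_generating (a b s z₁ z₂ : ℂ) (hb : ∀ m : ℕ, b ≠ -(m : ℂ))
    (h₁ : ‖z₁‖ < 1) (h₂ : ‖z₂‖ < 1) (h0 : z₁ ≠ 0) :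
    ∑' n : ℕ, laguerre n (b - 1) s * z₁ ^ n * F21 (-(n : ℂ)) a b (1 - z₂ / z₁)
      = (1 - z₁) ^ (a - b) * (1 - z₂) ^ (-a) * Complex.exp (s * z₁ / (z₁ - 1)) *
        F11 a b (s * (z₁ - z₂) / ((z₁ - 1) * (z₂ - 1))) := by
  have hz₁ : 1 - z₁ ≠ 0 := by
    intro h
    rw [← sub_eq_zero.mp h] at h₁; simp at h₁
  have hz₂ : 1 - z₂ ≠ 0 := by
    intro h
    rw [← sub_eq_zero.mp h] at h₂; simp at h₂
  have hS := double_summable a b s z₁ z₂ hb h₁ h₂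
  have step1 : ∀ n : ℕ, laguerre n (b - 1) s * z₁ ^ n * F21 (-(n : ℂ)) a b (1 - z₂ / z₁)
      = ∑' k : ℕ, (n.choose k : ℂ) * ((-s) ^ k / poch b k) * Gp (b - a) a z₁ z₂ n := by
    intro n
    rw [lag_term n a b s z₁ z₂ hb h0, tsum_eq_sum]
    intro k hk
    rw [Nat.choose_eq_zero_of_lt (by simpa using hk)]; simp
  rw [tsum_congr step1, ← Summable.tsum_comm hS]
  have step2 : ∀ k : ℕ, ∑' n : ℕ, (n.choose k : ℂ) * ((-s) ^ k / poch b k) * Gp (b - a) a z₁ z₂ n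
      = (1 - z₁) ^ (-(b - a)) * (1 - z₂) ^ (-a) *
        ((-s) ^ k / poch b k * Gp (b - a) a (z₁ / (1 - z₁)) (z₂ / (1 - z₂)) k) := by
    intro k
    have h := ((Gp_choose_hasSum (b - a) a z₁ z₂ h₁ h₂ k).mul_left ((-s) ^ k / poch b k)).tsum_eq
    rw [mul_left_comm, ← h]
    refine tsum_congr fun n => ?_
    ring
  rw [tsum_congr step2, tsum_mul_left, (final_sum a b s _ _ hb).tsum_eq]
  have e1 : s * (z₁ / (1 - z₁) - z₂ / (1 - z₂)) = s * (z₁ - z₂) / ((z₁ - 1) * (z₂ - 1)) := by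
    rw [← neg_sub 1 z₁, ← neg_sub 1 z₂]
    field_simp
    ring
  have e2 : -s * (z₁ / (1 - z₁)) = s * z₁ / (z₁ - 1) := by
    rw [← neg_sub 1 z₁]
    field_simp
  rw [e1, e2, neg_sub]
  ring
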